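/- arXiv:1309.1420 — 2 statements merged into one kernel-verified Lean document; each statement's English description precedes it below -/
import Mathlib

section
/- For each t and ω ∈ Ω_t, Λ_t(ω) = Γ_t(ω)*, where Λ_t(ω) := {x ∈ ℝ^d : x ∈ K̃_{t+1}(ω,·) 𝒫_t(ω)-q.s.}, Γ_t(ω) := supp_{𝒫_t(ω)} K̃*_{t+1}(ω,·), and * denotes the dual cone. -/
open MeasureTheory Set
open scoped ENNReal

noncomputable section

/-- Convexity for a set of probability measures. -/
def ConvexProb {α : Type*} [MeasurableSpace α] (𝒬 : Set (ProbabilityMeasure α)) : Prop :=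
  ∀ P ∈ 𝒬, ∀ Q ∈ 𝒬, ∀ a b : ℝ≥0∞, a + b = 1 → ∀ R : ProbabilityMeasure α,
    (R : Measure α) = a • (P : Measure α) + b • (Q : Measure α) → R ∈ 𝒬

/-- The dual cone of a set in `ℝ^d`. -/
def dualCone {d : ℕ} (C : Set (Fin d → ℝ)) : Set (Fin d → ℝ) :=
  {y | ∀ x ∈ C, 0 ≤ ∑ i, x i * y i}

/-- The support of a set-valued map under a family of probability measures: the smallest closed
set `F ⊆ ℝ^d` such that `P(C(·) ⊆ F) = 1` for every member `P` of the family. -/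
def svSupport {α : Type*} [MeasurableSpace α] {d : ℕ} (𝒬 : Set (ProbabilityMeasure α))
    (C : α → Set (Fin d → ℝ)) : Set (Fin d → ℝ) :=
  ⋂₀ {F : Set (Fin d → ℝ) | IsClosed F ∧ ∀ P ∈ 𝒬, (P : Measure α) {x | C x ⊆ F} = 1}

/-- `Λ_t(ω)`: the vectors lying in the cone `K̃_{t+1}(ω,·) = (K̃*_{t+1}(ω,·))*`,
`𝒫_t(ω)`-quasi-surely. -/
def LambdaSet {Ω₁ : Type*} [MeasurableSpace Ω₁] {t d : ℕ}
    (𝒬t : (Fin t → Ω₁) → Set (ProbabilityMeasure Ω₁))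
    (Kt1star : (Fin t → Ω₁) × Ω₁ → Set (Fin d → ℝ)) (ω : Fin t → Ω₁) : Set (Fin d → ℝ) :=
  {x | ∀ P ∈ 𝒬t ω, ∀ᵐ ω' ∂(P : Measure Ω₁), x ∈ dualCone (Kt1star (ω, ω'))}

/-- `Γ_t(ω) := supp_{𝒫_t(ω)} K̃*_{t+1}(ω, ·)`. -/
def GammaSet {Ω₁ : Type*} [MeasurableSpace Ω₁] {t d : ℕ}
    (𝒬t : (Fin t → Ω₁) → Set (ProbabilityMeasure Ω₁))
    (Kt1star : (Fin t → Ω₁) × Ω₁ → Set (Fin d → ℝ)) (ω : Fin t → Ω₁) : Set (Fin d → ℝ) :=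
  svSupport (𝒬t ω) (fun ω' => Kt1star (ω, ω'))

/-- In a metrizable space, the continuous image of `{x | ∀ i, x i ≤ g i}` is the intersection of the
closures of the images of the sets obtained by bounding only finitely many coordinates. -/
theorem iInter_closure_image_subset {X : Type*} [TopologicalSpace X]
    [TopologicalSpace.MetrizableSpace X] {f : (ℕ → ℕ) → X} (hf : Continuous f) (g : ℕ → ℕ) :
    ⋂ n, closure (f '' {x | ∀ i < n, x i ≤ g i}) ⊆ f '' {x | ∀ i, x i ≤ g i} := by
  let := TopologicalSpace.metrizableSpaceMetric X
  intro y hy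
  have hx : ∀ n : ℕ, ∃ x : ℕ → ℕ, (∀ i < n, x i ≤ g i) ∧ dist y (f x) < 1 / ((n : ℝ) + 1) := by
    intro n
    obtain ⟨_, ⟨x, hx, rfl⟩, hd⟩ :=
      Metric.mem_closure_iff.1 (mem_iInter.1 hy n) _ (Nat.one_div_pos_of_nat (α := ℝ))
    exact ⟨x, hx, hd⟩
  choose x hxg hxd using hx
  have hC : IsCompact (Set.pi univ fun i => Iic (g i)) :=
    isCompact_univ_pi fun i => (finite_Iic (g i)).isCompact
  obtain ⟨z, hz, φ, hφ, hlim⟩ := hC.tendsto_subseq (x := fun n i => min (x n i) (g i))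
    fun n i _ => min_le_right (x n i) (g i)
  have hxz : Filter.Tendsto (x ∘ φ) Filter.atTop (nhds z) := by
    rw [tendsto_pi_nhds] at hlim ⊢
    intro i
    refine (hlim i).congr' ?_
    filter_upwards [Filter.eventually_gt_atTop i] with n hn
    exact min_eq_left (hxg (φ n) i (hn.trans_le (hφ.id_le n)))
  have hfy : Filter.Tendsto (fun n => f (x n)) Filter.atTop (nhds y) := by
    rw [tendsto_iff_dist_tendsto_zero]
    refine squeeze_zero (fun _ => dist_nonneg) (fun n => ?_)
      (tendsto_one_div_add_atTop_nhds_zero_nat (𝕜 := ℝ))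
    rw [dist_comm]
    exact (hxd n).le
  exact ⟨z, fun i => hz i (mem_univ i),
    tendsto_nhds_unique ((hf.tendsto z).comp hxz) (hfy.comp hφ.tendsto_atTop)⟩

/-- Any number below the measure of a continuous image of the Baire space is a lower bound for the
measure of some compact subset of it. -/
theorem exists_isCompact_subset_range_le_measure {X : Type*} [TopologicalSpace X]
    [TopologicalSpace.MetrizableSpace X] [MeasurableSpace X] [OpensMeasurableSpace X]
    (μ : Measure X) [IsFiniteMeasure μ] {f : (ℕ → ℕ) → X} (hf : Continuous f) {c : ℝ≥0∞}
    (hc : c < μ (range f)) : ∃ K ⊆ range f, IsCompact K ∧ c ≤ μ K := by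
  have hstep : ∀ (n : ℕ) (S : {S : Set (ℕ → ℕ) // c < μ (f '' S)}),
      ∃ k : ℕ, c < μ (f '' (S.1 ∩ {x | x n ≤ k})) := by
    rintro n ⟨S, hS⟩
    have hU : ⋃ k : ℕ, f '' (S ∩ {x | x n ≤ k}) = f '' S := by
      rw [← image_iUnion, ← inter_iUnion]
      congr 1
      exact inter_eq_left.2 fun x _ => mem_iUnion.2 ⟨x n, le_refl (x n)⟩
    have hmono : Monotone fun k : ℕ => f '' (S ∩ {x | x n ≤ k}) := fun a b hab =>
      image_mono (inter_subset_inter_right _ fun x (hx : x n ≤ a) => hx.trans hab)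
    rw [← hU, hmono.measure_iUnion] at hS
    exact lt_iSup_iff.1 hS
  choose k hk using hstep
  let T : ℕ → {S : Set (ℕ → ℕ) // c < μ (f '' S)} := fun n =>
    Nat.rec ⟨univ, by rwa [image_univ]⟩ (fun n S => ⟨_, hk n S⟩) n
  let g : ℕ → ℕ := fun n => k n (T n)
  have hT : ∀ n, (T n).1 = {x | ∀ i < n, x i ≤ g i} := by
    intro n
    induction n with
    | zero => simp [T]
    | succ n ih =>
      have hsucc : (T (n + 1)).1 = (T n).1 ∩ {x | x n ≤ g n} := rfl
      rw [hsucc, ih]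
      ext x
      exact Nat.forall_lt_succ_right.symm
  refine ⟨f '' {x | ∀ i, x i ≤ g i}, image_subset_range _ _, ?_, ?_⟩
  · have hC : IsCompact (Set.pi univ fun i => Iic (g i)) :=
      isCompact_univ_pi fun i => (finite_Iic (g i)).isCompact
    convert hC.image hf using 2
    ext x
    simp [Pi.le_def]
  · refine le_trans ?_ (measure_mono (iInter_closure_image_subset hf g))
    have hanti : Antitone fun n => closure (f '' {x | ∀ i < n, x i ≤ g i}) := fun a b hab =>
      closure_mono (image_mono fun x hx i hi => hx i (hi.trans_le hab))
    rw [hanti.measure_iInter (fun n => isClosed_closure.measurableSet.nullMeasurableSet)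
      ⟨0, measure_ne_top _ _⟩]
    refine le_iInf fun n => le_trans ?_ (measure_mono subset_closure)
    rw [← hT n]
    exact (T n).2.le

/-- Analytic sets are universally measurable. -/
theorem MeasureTheory.AnalyticSet.nullMeasurableSet {X : Type*} [TopologicalSpace X]
    [TopologicalSpace.MetrizableSpace X] [MeasurableSpace X] [OpensMeasurableSpace X] {s : Set X}
    (hs : AnalyticSet s) (μ : Measure X) [IsFiniteMeasure μ] : NullMeasurableSet s μ := by
  rw [AnalyticSet] at hs
  rcases hs with rfl | ⟨f, hf, rfl⟩
  · exact MeasurableSet.empty.nullMeasurableSet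
  rcases eq_or_ne (μ (range f)) 0 with h0 | h0
  · exact NullMeasurableSet.of_null h0
  obtain ⟨u, -, hu, hlim⟩ := exists_seq_strictMono_tendsto' (pos_iff_ne_zero.2 h0)
  choose K hKs hK hKu using fun n => exists_isCompact_subset_range_le_measure μ hf (hu n).2
  have hM : MeasurableSet (⋃ n, K n) := .iUnion fun n => (hK n).isClosed.measurableSet
  have hle : μ (range f) ≤ μ (⋃ n, K n) :=
    le_of_tendsto' hlim fun n => (hKu n).trans (measure_mono (subset_iUnion K n))
  exact hM.nullMeasurableSet.congr
    (ae_eq_of_subset_of_measure_ge (iUnion_subset hKs) hle hM.nullMeasurableSet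
      (measure_ne_top _ _))

/-- A set-valued map with analytic graph takes values in its support almost surely. -/
theorem ae_subset_svSupport {α : Type*} [TopologicalSpace α] [PolishSpace α] [MeasurableSpace α]
    [BorelSpace α] {d : ℕ} {𝒬 : Set (ProbabilityMeasure α)} {C : α → Set (Fin d → ℝ)}
    (hC : AnalyticSet {q : α × (Fin d → ℝ) | q.2 ∈ C q.1}) {P : ProbabilityMeasure α}
    (hP : P ∈ 𝒬) : ∀ᵐ a ∂(P : Measure α), C a ⊆ svSupport 𝒬 C := by
  obtain ⟨S, hS, hSc, hSeq⟩ := TopologicalSpace.isOpen_sUnion_countable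
    (compl '' {F : Set (Fin d → ℝ) | IsClosed F ∧ ∀ P ∈ 𝒬, (P : Measure α) {x | C x ⊆ F} = 1})
    (by rintro _ ⟨F, hF, rfl⟩; exact hF.1.isOpen_compl)
  have hsupp : svSupport 𝒬 C = ⋂ U ∈ S, Uᶜ := by
    rw [svSupport, ← compl_inj_iff, compl_sInter, ← hSeq, sUnion_eq_biUnion]
    simp
  rw [hsupp]
  simp only [subset_iInter_iff]
  rw [ae_ball_iff hS]
  intro U hU
  obtain ⟨F, ⟨hFcl, hF⟩, rfl⟩ := hSc hU
  rw [compl_compl]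
  have hproj : {a | C a ⊆ F}ᶜ =
      Prod.fst '' ({q : α × (Fin d → ℝ) | q.2 ∈ C q.1} ∩ Prod.snd ⁻¹' Fᶜ) := by
    ext a
    simp [not_subset]
  have hopen : AnalyticSet (Prod.snd ⁻¹' Fᶜ : Set (α × (Fin d → ℝ))) :=
    (hFcl.isOpen_compl.preimage continuous_snd).measurableSet.analyticSet
  have hinter : AnalyticSet ({q : α × (Fin d → ℝ) | q.2 ∈ C q.1} ∩ Prod.snd ⁻¹' Fᶜ) := by
    rw [inter_eq_iInter]
    exact .iInter fun b => by cases b <;> assumption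
  have hnull : NullMeasurableSet {a | C a ⊆ F} (P : Measure α) := by
    rw [← NullMeasurableSet.compl_iff, hproj]
    exact (hinter.image_of_continuous continuous_fst).nullMeasurableSet _
  exact (prob_compl_eq_zero_iff₀ hnull).2 (hF P hP)

/-- Lemma 5.8: `Λ_t = Γ_t*`. -/
theorem Lambda_eq_dual_Gamma {Ω₁ : Type*} [TopologicalSpace Ω₁] [PolishSpace Ω₁]
    [MeasurableSpace Ω₁] [BorelSpace Ω₁] (t d : ℕ)
    (𝒬t : (Fin t → Ω₁) → Set (ProbabilityMeasure Ω₁))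
    (h𝒬ne : ∀ ω, (𝒬t ω).Nonempty) (h𝒬conv : ∀ ω, ConvexProb (𝒬t ω))
    (h𝒬graph : AnalyticSet {p : (Fin t → Ω₁) × ProbabilityMeasure Ω₁ | p.2 ∈ 𝒬t p.1})
    (Kt1star : (Fin t → Ω₁) × Ω₁ → Set (Fin d → ℝ))
    (hne : ∀ p, (Kt1star p).Nonempty) (hcl : ∀ p, IsClosed (Kt1star p))
    (hconv : ∀ p, Convex ℝ (Kt1star p))
    (hcone : ∀ p, ∀ c : ℝ, 0 ≤ c → ∀ x ∈ Kt1star p, c • x ∈ Kt1star p)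
    (hgraph : AnalyticSet {q : ((Fin t → Ω₁) × Ω₁) × (Fin d → ℝ) | q.2 ∈ Kt1star q.1}) :
    ∀ ω, LambdaSet 𝒬t Kt1star ω = dualCone (GammaSet 𝒬t Kt1star ω) := by
  intro ω
  have hsec : AnalyticSet {q : Ω₁ × (Fin d → ℝ) | q.2 ∈ Kt1star (ω, q.1)} :=
    hgraph.preimage (f := fun q : Ω₁ × (Fin d → ℝ) => ((ω, q.1), q.2)) (by fun_prop)
  apply Subset.antisymm
  · intro x hx y hy
    refine mem_sInter.1 hy {y | 0 ≤ ∑ i, y i * x i} ⟨isClosed_le (by fun_prop) (by fun_prop), ?_⟩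
    intro P hP
    exact (measure_congr (Filter.eventuallyEq_univ.2 (hx P hP))).trans measure_univ
  · intro x hx P hP
    filter_upwards [ae_subset_svSupport (C := fun ω' => Kt1star (ω, ω')) hsec hP] with ω' hω' y hy
    exact hx y (hω' hy)
end
end

section
/- For each t and ω ∈ Ω_t, NA₂(𝒫_t(ω)) holds for the one-period market {K̃_t(ω), K̃_{t+1}(ω,·)}; that is, Λ_t(ω) ⊆ K̃_t(ω), where Λ_t(ω) := {x ∈ ℝ^d : x ∈ K̃_{t+1}(ω,·) 𝒫_t(ω)-q.s.}. -/
open MeasureTheory Set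
open scoped ENNReal

noncomputable section

/-- Corollary 5.10: the one-period market `{K̃_t(ω), K̃_{t+1}(ω,·)}`
satisfies `NA₂(𝒫_t(ω))`, i.e. `Λ_t(ω) ⊆ K̃_t(ω)`. -/
theorem modified_market_one_period_NA2 {Ω₁ : Type*} [TopologicalSpace Ω₁] [PolishSpace Ω₁]
    [MeasurableSpace Ω₁] [BorelSpace Ω₁] (t d : ℕ)
    (𝒬t : (Fin t → Ω₁) → Set (ProbabilityMeasure Ω₁))
    (h𝒬ne : ∀ ω, (𝒬t ω).Nonempty) (h𝒬conv : ∀ ω, ConvexProb (𝒬t ω))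
    (h𝒬graph : AnalyticSet {p : (Fin t → Ω₁) × ProbabilityMeasure Ω₁ | p.2 ∈ 𝒬t p.1})
    (K : (Fin t → Ω₁) → Set (Fin d → ℝ))
    (hKcl : ∀ ω, IsClosed (K ω)) (hKconv : ∀ ω, Convex ℝ (K ω))
    (hKcone : ∀ ω, ∀ c : ℝ, 0 ≤ c → ∀ x ∈ K ω, c • x ∈ K ω)
    (hKorth : ∀ ω, {x : Fin d → ℝ | ∀ i, 0 ≤ x i} ⊆ K ω)
    (hKgraph : AnalyticSet {p : (Fin t → Ω₁) × (Fin d → ℝ) | p.2 ∈ dualCone (K p.1)})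
    (Kt1star : (Fin t → Ω₁) × Ω₁ → Set (Fin d → ℝ))
    (hne : ∀ p, (Kt1star p).Nonempty) (hcl : ∀ p, IsClosed (Kt1star p))
    (hconv : ∀ p, Convex ℝ (Kt1star p))
    (hcone : ∀ p, ∀ c : ℝ, 0 ≤ c → ∀ x ∈ Kt1star p, c • x ∈ Kt1star p)
    (hgraph : AnalyticSet {q : ((Fin t → Ω₁) × Ω₁) × (Fin d → ℝ) | q.2 ∈ Kt1star q.1}) :
    ∀ ω, LambdaSet 𝒬t Kt1star ω ⊆
      dualCone (dualCone (K ω) ∩ closure (convexHull ℝ (GammaSet 𝒬t Kt1star ω))) := by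
  intro ω x hx y hy
  have hclosed : IsClosed {z : Fin d → ℝ | 0 ≤ ∑ i, z i * x i} :=
    isClosed_le continuous_const (by fun_prop)
  have hconvex : Convex ℝ {z : Fin d → ℝ | 0 ≤ ∑ i, z i * x i} := by
    intro u hu v hv a b ha hb _
    have h : ∑ i, (a • u + b • v) i * x i = a * ∑ i, u i * x i + b * ∑ i, v i * x i := by
      simp only [Finset.mul_sum, ← Finset.sum_add_distrib, Pi.add_apply, Pi.smul_apply,
        smul_eq_mul]
      exact Finset.sum_congr rfl fun i _ => by ring
    rw [mem_ofPred_eq, h]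
    exact add_nonneg (mul_nonneg ha hu) (mul_nonneg hb hv)
  have hsupport : GammaSet 𝒬t Kt1star ω ⊆ {z : Fin d → ℝ | 0 ≤ ∑ i, z i * x i} := by
    refine sInter_subset_of_mem ⟨hclosed, fun P hP => ?_⟩
    have h := measure_congr (Filter.eventuallyEq_univ.mpr (hx P hP))
    rw [measure_univ] at h
    exact h
  exact closure_minimal (convexHull_min hsupport hconvex) hclosed hy.2
end
end
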